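/- Let α ∈ (0,1). There is a positive constant c(α) (depending only on α and the sequence m) such that for every integer k ≥ 1 and every integer n with M_k ≤ n < M_{k+1}, ∫_{G_m} | Σ_{v=M_{k−1}}^{M_k − 1} A_{n−v}^{−α} ψ_v(u) | dμ(u) ≤ c(α). -/

import Mathlib

open MeasureTheory Filter Finset
open scoped ENNReal NNReal Real

noncomputable section

namespace Vilenkin

/-- The bounded Vilenkin group: complete direct product of the cyclic groups `ZMod (m k)`. -/
abbrev G (m : ℕ → ℕ) : Type := ∀ k, ZMod (m k)

/-- The generalized number system `M 0 = 1`, `M (k+1) = m k * M k`. -/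
def M (m : ℕ → ℕ) : ℕ → ℕ
  | 0 => 1
  | k + 1 => m k * M m k

/-- The cylinder neighbourhood `I n = {x | x 0 = ⋯ = x (n-1) = 0}`. -/
def I (m : ℕ → ℕ) (n : ℕ) : Set (G m) := {x | ∀ j < n, x j = 0}

/-- The `j`-th digit of `n` in the generalized number system based on `m`. -/
def digit (m : ℕ → ℕ) (n j : ℕ) : ℕ := n / M m j % m j

/-- The generalized Rademacher functions `r k x = exp (2 π i x_k / m_k)`. -/
def rad (m : ℕ → ℕ) (k : ℕ) (x : G m) : ℂ :=
  Complex.exp (2 * Real.pi * Complex.I * ((x k).val : ℂ) / (m k : ℂ))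

/-- The Vilenkin system `ψ n = ∏ k, (r k) ^ (n_k)`. -/
def psi (m : ℕ → ℕ) (n : ℕ) (x : G m) : ℂ :=
  ∏ k ∈ Finset.range (n + 1), rad m k x ^ digit m n k

/-- The Vilenkin-Dirichlet kernels `D n = ∑_{k<n} ψ k`. -/
def D (m : ℕ → ℕ) (n : ℕ) (x : G m) : ℂ := ∑ k ∈ Finset.range n, psi m k x

/-- The Cesàro numbers `A n α = (α+1)⋯(α+n)/n!`. -/
def A (α : ℝ) (n : ℕ) : ℝ := (∏ i ∈ Finset.range n, (α + (i + 1))) / (n.factorial : ℝ)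

/-- One-dimensional Vilenkin-Fourier coefficients. -/
def fhat1 (m : ℕ → ℕ) (μ : Measure (G m)) (f : G m → ℂ) (i : ℕ) : ℂ :=
  ∫ x, f x * (starRingEnd ℂ) (psi m i x) ∂μ

/-- One-dimensional `(C,-α)` Cesàro means of the Vilenkin-Fourier series. -/
def cesaro1 (m : ℕ → ℕ) (μ : Measure (G m)) (α : ℝ) (f : G m → ℂ) (n : ℕ) (x : G m) : ℂ :=
  ((A (-α) n : ℝ) : ℂ)⁻¹ *
    ∑ i ∈ Finset.range (n + 1), ((A (-α) (n - i) : ℝ) : ℂ) * fhat1 m μ f i * psi m i x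

/-- Double Vilenkin-Fourier coefficients. -/
def fhat2 (m : ℕ → ℕ) (μ : Measure (G m)) (f : G m × G m → ℂ) (i j : ℕ) : ℂ :=
  ∫ z, f z * (starRingEnd ℂ) (psi m i z.1) * (starRingEnd ℂ) (psi m j z.2) ∂(μ.prod μ)

/-- Rectangular partial sums of the double Vilenkin-Fourier series. -/
def partialSum2 (m : ℕ → ℕ) (μ : Measure (G m)) (f : G m × G m → ℂ) (n₁ n₂ : ℕ)
    (z : G m × G m) : ℂ :=
  ∑ k₁ ∈ Finset.range n₁, ∑ k₂ ∈ Finset.range n₂,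
    fhat2 m μ f k₁ k₂ * psi m k₁ z.1 * psi m k₂ z.2

/-- The `(C,-α,-β)` means of the double Vilenkin-Fourier series. -/
def cesaro2 (m : ℕ → ℕ) (μ : Measure (G m)) (α β : ℝ) (f : G m × G m → ℂ) (n₁ n₂ : ℕ)
    (z : G m × G m) : ℂ :=
  ((A (-α) n₁ * A (-β) n₂ : ℝ) : ℂ)⁻¹ *
    ∑ i ∈ Finset.range (n₁ + 1), ∑ j ∈ Finset.range (n₂ + 1),
      ((A (-α) (n₁ - i) * A (-β) (n₂ - j) : ℝ) : ℂ) * fhat2 m μ f i j * psi m i z.1 * psi m j z.2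

/-- One-dimensional modulus of continuity in `L^p`. -/
def omegaOne (m : ℕ → ℕ) (μ : Measure (G m)) (p : ℝ≥0∞) (f : G m → ℂ) (n : ℕ) : ℝ≥0∞ :=
  ⨆ u ∈ I m n, eLpNorm (fun x => f (x - u) - f x) p μ

/-- First partial modulus of continuity in `L^p`. -/
def omega1 (m : ℕ → ℕ) (μ : Measure (G m)) (p : ℝ≥0∞) (f : G m × G m → ℂ) (n : ℕ) : ℝ≥0∞ :=
  ⨆ u ∈ I m n, eLpNorm (fun z => f (z.1 - u, z.2) - f z) p (μ.prod μ)

/-- Second partial modulus of continuity in `L^p`. -/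
def omega2 (m : ℕ → ℕ) (μ : Measure (G m)) (p : ℝ≥0∞) (f : G m × G m → ℂ) (n : ℕ) : ℝ≥0∞ :=
  ⨆ v ∈ I m n, eLpNorm (fun z => f (z.1, z.2 - v) - f z) p (μ.prod μ)

/-- Mixed modulus of continuity in `L^p`. -/
def omega12 (m : ℕ → ℕ) (μ : Measure (G m)) (p : ℝ≥0∞) (f : G m × G m → ℂ) (n l : ℕ) : ℝ≥0∞ :=
  ⨆ u ∈ I m n, ⨆ v ∈ I m l,
    eLpNorm (fun z => f (z.1 - u, z.2 - v) - f (z.1 - u, z.2) - f (z.1, z.2 - v) + f z) p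
      (μ.prod μ)

/-- Total modulus of continuity in `L^p`. -/
def omegaT (m : ℕ → ℕ) (μ : Measure (G m)) (p : ℝ≥0∞) (f : G m × G m → ℂ) (n : ℕ) : ℝ≥0∞ :=
  ⨆ u ∈ I m n, ⨆ v ∈ I m n, eLpNorm (fun z => f (z.1 - u, z.2 - v) - f z) p (μ.prod μ)

/-- Total modulus of continuity in the uniform norm. -/
def omegaC (m : ℕ → ℕ) (f : G m × G m → ℂ) (n : ℕ) : ℝ≥0∞ :=
  ⨆ u ∈ I m n, ⨆ v ∈ I m n, ⨆ z : G m × G m, (‖f (z.1 - u, z.2 - v) - f z‖₊ : ℝ≥0∞)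


lemma M_pos {m : ℕ → ℕ} (hm2 : ∀ k, 2 ≤ m k) (k : ℕ) : 0 < M m k := by
  induction k with
  | zero => simp [M]
  | succ k ih => exact Nat.mul_pos (by have := hm2 k; omega) ih

lemma two_pow_le_M {m : ℕ → ℕ} (hm2 : ∀ k, 2 ≤ m k) (k : ℕ) : 2 ^ k ≤ M m k := by
  induction k with
  | zero => simp [M]
  | succ k ih =>
    rw [pow_succ', M]
    exact Nat.mul_le_mul (hm2 k) ih

lemma M_dvd_M_of_le (m : ℕ → ℕ) {j k : ℕ} (h : j ≤ k) : M m j ∣ M m k := by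
  induction k, h using Nat.le_induction with
  | base => rfl
  | succ k _ ih => exact ih.trans (Dvd.intro_left (m k) rfl)

/-- The product of the first `k` factors of a Vilenkin function. -/
def psiTrunc (m : ℕ → ℕ) (k n : ℕ) (x : G m) : ℂ :=
  ∏ i ∈ Finset.range k, rad m i x ^ digit m n i

lemma digit_eq_zero_of_lt {m : ℕ → ℕ} {n j : ℕ} (h : n < M m j) : digit m n j = 0 := by
  simp [digit, Nat.div_eq_of_lt h]

lemma psi_eq_psiTrunc {m : ℕ → ℕ} (hm2 : ∀ k, 2 ≤ m k) {k n : ℕ} (h : n < M m k) (x : G m) :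
    psi m n x = psiTrunc m k n x := by
  have key : ∀ a b : ℕ, a ≤ b → n < M m a → psiTrunc m a n x = psiTrunc m b n x := by
    intro a b hab ha
    refine Finset.prod_subset (Finset.range_mono hab) fun j _ hj => ?_
    have hj' : a ≤ j := by simpa using hj
    rw [digit_eq_zero_of_lt, pow_zero]
    exact ha.trans_le (Nat.le_of_dvd (M_pos hm2 j) (M_dvd_M_of_le m hj'))
  have hn : n < M m (n + 1) :=
    (Nat.lt_two_pow_self.trans (Nat.pow_lt_pow_right one_lt_two n.lt_succ_self)).trans_le
      (two_pow_le_M hm2 _)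
  change psiTrunc m (n + 1) n x = _
  rcases le_total (n + 1) k with hk | hk
  · exact key _ _ hk hn
  · exact (key _ _ hk h).symm

lemma digit_mul_M_add_self {m : ℕ → ℕ} {k q r : ℕ} (hq : q < m k) (hr : r < M m k) :
    digit m (q * M m k + r) k = q := by
  have h : (q * M m k + r) / M m k = q := by
    rw [mul_comm, Nat.mul_add_div (by omega), Nat.div_eq_of_lt hr, add_zero]
  rw [digit, h, Nat.mod_eq_of_lt hq]

lemma digit_mul_M_add_of_lt {m : ℕ → ℕ} (hm2 : ∀ k, 2 ≤ m k) {j k : ℕ} (q r : ℕ) (hj : j < k) :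
    digit m (q * M m k + r) j = digit m r j := by
  obtain ⟨t, ht⟩ := M_dvd_M_of_le m (Nat.succ_le_of_lt hj)
  have h : q * M m k + r = M m j * (m j * (t * q)) + r := by
    rw [ht, M]; ring
  rw [digit, digit, h, Nat.mul_add_div (M_pos hm2 j), Nat.mul_add_mod]

lemma psiTrunc_succ_mul_add {m : ℕ → ℕ} (hm2 : ∀ k, 2 ≤ m k) {k q r : ℕ} (hq : q < m k)
    (hr : r < M m k) (x : G m) :
    psiTrunc m (k + 1) (q * M m k + r) x = rad m k x ^ q * psiTrunc m k r x := by
  rw [psiTrunc, Finset.prod_range_succ, digit_mul_M_add_self hq hr, mul_comm, psiTrunc]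
  congr 1
  refine Finset.prod_congr rfl fun j hj => ?_
  rw [digit_mul_M_add_of_lt hm2 q r (Finset.mem_range.mp hj)]

lemma norm_rad (m : ℕ → ℕ) (k : ℕ) (x : G m) : ‖rad m k x‖ = 1 := by
  have h : (2 * Real.pi * Complex.I * ((x k).val : ℂ) / (m k : ℂ))
      = ((2 * Real.pi * (x k).val / m k : ℝ) : ℂ) * Complex.I := by
    push_cast; ring
  rw [rad, h, Complex.norm_exp_ofReal_mul_I]

lemma norm_psiTrunc (m : ℕ → ℕ) (k n : ℕ) (x : G m) : ‖psiTrunc m k n x‖ = 1 := by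
  simp [psiTrunc, norm_prod, norm_rad]

lemma psiTrunc_reflect {m : ℕ → ℕ} (hm2 : ∀ k, 2 ≤ m k) (x : G m) (k : ℕ) :
    ∀ n < M m k, psiTrunc m k (M m k - 1 - n) x * psiTrunc m k n x
      = psiTrunc m k (M m k - 1) x := by
  induction k with
  | zero => simp [psiTrunc]
  | succ k ih =>
    intro n hn
    have hM := M_pos hm2 k
    have hm := hm2 k
    have hq : n / M m k < m k := Nat.div_lt_of_lt_mul (by rwa [M, mul_comm] at hn)
    have hr : n % M m k < M m k := Nat.mod_lt _ hM
    obtain ⟨q, hq'⟩ : ∃ q, q = n / M m k := ⟨_, rfl⟩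
    obtain ⟨r, hr'⟩ : ∃ r, r = n % M m k := ⟨_, rfl⟩
    rw [← hq'] at hq
    rw [← hr'] at hr
    have hn' : n = q * M m k + r := by rw [hq', hr']; exact (Nat.div_add_mod' _ _).symm
    have htop : M m (k + 1) - 1 = (m k - 1) * M m k + (M m k - 1) := by
      obtain ⟨p, hp⟩ : ∃ p, m k = p + 1 := ⟨m k - 1, by omega⟩
      rw [M, hp, add_mul]
      simp only [Nat.add_sub_cancel]
      omega
    have hrefl : M m (k + 1) - 1 - n = (m k - 1 - q) * M m k + (M m k - 1 - r) := by
      obtain ⟨p, hp⟩ : ∃ p, m k - 1 = q + p := ⟨m k - 1 - q, by omega⟩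
      rw [htop, hn', hp, add_mul, Nat.add_sub_cancel_left]
      omega
    rw [hrefl, htop, hn', psiTrunc_succ_mul_add hm2 (by omega) (by omega),
      psiTrunc_succ_mul_add hm2 hq hr, psiTrunc_succ_mul_add hm2 (by omega) (by omega),
      mul_mul_mul_comm, ih r hr, ← pow_add]
    congr 2
    omega

/-- Block decomposition of the Dirichlet kernel. -/
lemma sum_psiTrunc_succ {m : ℕ → ℕ} (hm2 : ∀ k, 2 ≤ m k) (k : ℕ) (x : G m) {q r : ℕ}
    (hqr : q * M m k + r ≤ M m (k + 1)) (hr : r ≤ M m k) :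
    ∑ v ∈ Finset.range (q * M m k + r), psiTrunc m (k + 1) v x
      = (∑ t ∈ Finset.range q, rad m k x ^ t) * (∑ v ∈ Finset.range (M m k), psiTrunc m k v x)
        + rad m k x ^ q * ∑ v ∈ Finset.range r, psiTrunc m k v x := by
  have hM := M_pos hm2 k
  have tail : ∀ q r, q * M m k + r ≤ M m (k + 1) → r ≤ M m k →
      ∑ v ∈ Finset.range r, psiTrunc m (k + 1) (q * M m k + v) x
        = rad m k x ^ q * ∑ v ∈ Finset.range r, psiTrunc m k v x := by
    intro q r hqr hr
    rw [Finset.mul_sum]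
    refine Finset.sum_congr rfl fun v hv => ?_
    have hv' := Finset.mem_range.mp hv
    refine psiTrunc_succ_mul_add hm2 ?_ (by omega) x
    rw [M] at hqr
    by_contra! hcon
    have := Nat.mul_le_mul_right (M m k) hcon
    omega
  rw [Finset.sum_range_add, tail q r hqr hr]
  congr 1
  have hq : q * M m k ≤ M m (k + 1) := by omega
  clear hqr
  induction q with
  | zero => simp
  | succ q ih =>
    rw [add_mul, one_mul] at hq ⊢
    rw [Finset.sum_range_add, tail q _ hq le_rfl, ih (by omega), Finset.sum_range_succ, add_mul]

lemma sum_rad_pow {m : ℕ → ℕ} (hm2 : ∀ k, 2 ≤ m k) (k : ℕ) (x : G m) (hx : x k ≠ 0) :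
    ∑ t ∈ Finset.range (m k), rad m k x ^ t = 0 := by
  have hm : m k ≠ 0 := by have := hm2 k; omega
  have : NeZero (m k) := ⟨hm⟩
  have hprim := Complex.isPrimitiveRoot_exp (m k) hm
  have hrad : rad m k x = Complex.exp (2 * Real.pi * Complex.I / (m k : ℂ)) ^ (x k).val := by
    rw [rad, ← Complex.exp_nat_mul]
    congr 1
    ring
  have hne : rad m k x ≠ 1 := by
    rw [hrad]
    exact hprim.pow_ne_one_of_pos_of_lt (by simpa using hx) (ZMod.val_lt _)
  rw [geom_sum_eq hne, hrad, pow_right_comm, hprim.pow_eq_one, one_pow, sub_self,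
    zero_div]

lemma sum_psiTrunc_M {m : ℕ → ℕ} (hm2 : ∀ k, 2 ≤ m k) (x : G m) (k : ℕ) :
    ∑ v ∈ Finset.range (M m k), psiTrunc m k v x = (I m k).indicator (fun _ => (M m k : ℂ)) x := by
  classical
  induction k with
  | zero => simp [M, psiTrunc, I]
  | succ k ih =>
    have h := sum_psiTrunc_succ hm2 k x (q := m k) (r := 0) le_rfl (Nat.zero_le _)
    rw [add_zero, ih] at h
    change ∑ v ∈ Finset.range (m k * M m k), _ = _
    rw [h]
    have hmem : x ∈ I m (k + 1) ↔ x ∈ I m k ∧ x k = 0 := by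
      simp only [I, Set.mem_ofPred_eq]
      exact Nat.forall_lt_succ_right
    by_cases hk : x k = 0
    · have hrad : rad m k x = 1 := by simp [rad, hk]
      by_cases hI : x ∈ I m k <;> simp [Set.indicator, hmem, hk, hI, hrad, M]
    · rw [sum_rad_pow hm2 k x hk]
      simp [Set.indicator, hmem, hk]

/-- Pointwise bound for the Dirichlet kernels. -/
lemma norm_sum_psiTrunc_le {m : ℕ → ℕ} (hm2 : ∀ k, 2 ≤ m k) {B : ℕ} (hB : ∀ k, m k ≤ B)
    (x : G m) (k : ℕ) : ∀ n < M m k,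
    ‖∑ v ∈ Finset.range n, psiTrunc m k v x‖
      ≤ ∑ s ∈ Finset.range k, if M m s ≤ n then
          B * (I m s).indicator (fun _ => (M m s : ℝ)) x else 0 := by
  have hw : ∀ s, 0 ≤ B * (I m s).indicator (fun _ => (M m s : ℝ)) x := fun s =>
    mul_nonneg (by positivity) (Set.indicator_nonneg (fun _ _ => by positivity) _)
  induction k with
  | zero =>
    intro n hn
    have : n = 0 := by simpa [M] using hn
    simp [this]
  | succ k ih =>
    intro n hn
    have hM := M_pos hm2 k
    have hq : n / M m k < m k := Nat.div_lt_of_lt_mul (by rwa [M, mul_comm] at hn)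
    have hr : n % M m k < M m k := Nat.mod_lt _ hM
    have hn' : n / M m k * M m k + n % M m k = n := Nat.div_add_mod' _ _
    have h := sum_psiTrunc_succ hm2 k x (by rw [hn']; exact hn.le) hr.le
    rw [hn'] at h
    rw [h, Finset.sum_range_succ, add_comm (∑ s ∈ _, _)]
    refine (norm_add_le _ _).trans (add_le_add ?_ ?_)
    · rw [sum_psiTrunc_M hm2, norm_mul]
      split_ifs with hle
      · refine mul_le_mul ?_ ?_ (norm_nonneg _) (by positivity)
        · refine (norm_sum_le _ _).trans ?_
          simp only [norm_pow, norm_rad, one_pow, Finset.sum_const, Finset.card_range,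
            nsmul_eq_mul, mul_one]
          exact_mod_cast hq.le.trans (hB k)
        · rw [norm_indicator_eq_indicator_norm]
          simp
      · rw [Nat.div_eq_of_lt (not_le.mp hle)]
        simp
    · rw [norm_mul, norm_pow, norm_rad, one_pow, one_mul]
      refine (ih _ hr).trans (Finset.sum_le_sum fun s _ => ?_)
      have := Nat.mod_le n (M m k)
      split_ifs with h1 h2
      · exact le_rfl
      · omega
      · exact hw s
      · exact le_rfl

/-- Abel summation: a majorant of the partial sums of `z` by those of `w` passes to
antitone nonnegative weights. -/
lemma norm_sum_mul_le_of_antitone {a : ℕ → ℝ} (ha : Antitone a) (ha0 : ∀ n, 0 ≤ a n)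
    (z : ℕ → ℂ) (w : ℕ → ℝ) (N : ℕ)
    (h : ∀ n ≤ N, ‖∑ v ∈ Finset.range n, z v‖ ≤ ∑ v ∈ Finset.range n, w v) :
    ‖∑ v ∈ Finset.range N, (a v : ℂ) * z v‖ ≤ ∑ v ∈ Finset.range N, a v * w v := by
  have key : ∀ n ≤ N, ‖∑ v ∈ Finset.range n, (a v : ℂ) * z v
        - (a n : ℂ) * ∑ v ∈ Finset.range n, z v‖
      ≤ ∑ v ∈ Finset.range n, a v * w v - a n * ∑ v ∈ Finset.range n, w v := by
    intro n
    induction n with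
    | zero => simp
    | succ n ih =>
      intro hn
      have hd : 0 ≤ a n - a (n + 1) := sub_nonneg.mpr (ha n.le_succ)
      have e : ∑ v ∈ Finset.range (n + 1), (a v : ℂ) * z v
            - (a (n + 1) : ℂ) * ∑ v ∈ Finset.range (n + 1), z v
          = (∑ v ∈ Finset.range n, (a v : ℂ) * z v - (a n : ℂ) * ∑ v ∈ Finset.range n, z v)
            + ((a n - a (n + 1) : ℝ) : ℂ) * ∑ v ∈ Finset.range (n + 1), z v := by
        simp only [Finset.sum_range_succ]
        push_cast
        ring
      rw [e]
      refine (norm_add_le _ _).trans ((add_le_add (ih (by omega)) ?_).trans_eq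
        (b := _ + (a n - a (n + 1)) * ∑ v ∈ Finset.range (n + 1), w v) ?_)
      · rw [norm_mul, Complex.norm_real, Real.norm_of_nonneg hd]
        exact mul_le_mul_of_nonneg_left (h _ hn) hd
      · simp only [Finset.sum_range_succ]
        ring
  have e : ∑ v ∈ Finset.range N, (a v : ℂ) * z v
      = (∑ v ∈ Finset.range N, (a v : ℂ) * z v - (a N : ℂ) * ∑ v ∈ Finset.range N, z v)
        + (a N : ℂ) * ∑ v ∈ Finset.range N, z v := by ring
  rw [e]
  refine (norm_add_le _ _).trans ?_
  have h2 : ‖(a N : ℂ) * ∑ v ∈ Finset.range N, z v‖ ≤ a N * ∑ v ∈ Finset.range N, w v := by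
    rw [norm_mul, Complex.norm_real, Real.norm_of_nonneg (ha0 N)]
    exact mul_le_mul_of_nonneg_left (h N le_rfl) (ha0 N)
  linarith [key N le_rfl]

lemma A_succ (β : ℝ) (n : ℕ) : A β (n + 1) = A β n * ((β + (n + 1)) / (n + 1)) := by
  rw [A, A, Finset.prod_range_succ, Nat.factorial_succ]
  have : (n.factorial : ℝ) ≠ 0 := by positivity
  have : (n : ℝ) + 1 ≠ 0 := by positivity
  push_cast
  field_simp

lemma A_neg_nonneg {α : ℝ} (h1 : α ≤ 1) (n : ℕ) : 0 ≤ A (-α) n := by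
  refine div_nonneg (Finset.prod_nonneg fun i _ => ?_) (by positivity)
  have : (0 : ℝ) ≤ i := by positivity
  linarith

lemma antitone_A_neg {α : ℝ} (h0 : 0 ≤ α) (h1 : α ≤ 1) : Antitone (A (-α)) := by
  refine antitone_nat_of_succ_le fun n => ?_
  rw [A_succ]
  refine mul_le_of_le_one_right (A_neg_nonneg h1 n) ?_
  rw [div_le_one (by positivity)]
  linarith

lemma A_neg_le_rpow {α : ℝ} (h0 : 0 ≤ α) (h1 : α ≤ 1) (n : ℕ) :
    A (-α) n ≤ ((n : ℝ) + 1) ^ (-α) := by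
  induction n with
  | zero => simp [A]
  | succ n ih =>
    have hn : (0 : ℝ) < n + 1 := by positivity
    have hsplit : ((n + 1 : ℕ) : ℝ) + 1 = ((n : ℝ) + 1) * (1 + 1 / ((n : ℝ) + 1)) := by
      push_cast
      field_simp
    have hbern : (1 + 1 / ((n : ℝ) + 1)) ^ α ≤ 1 + α * (1 / ((n : ℝ) + 1)) :=
      rpow_one_add_le_one_add_mul_self
        (by have : 0 < 1 / ((n : ℝ) + 1) := by positivity
            linarith) h0 h1
    rw [A_succ, hsplit, Real.mul_rpow hn.le (by positivity)]
    refine mul_le_mul ih ?_ (div_nonneg (by linarith [(Nat.cast_nonneg n : (0 : ℝ) ≤ n)]) hn.le)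
      (by positivity)
    rw [Real.rpow_neg (by positivity)]
    refine le_trans ?_ (inv_anti₀ (by positivity) hbern)
    have hy : (-α + ((n : ℝ) + 1)) / (n + 1) = 1 - α * (1 / ((n : ℝ) + 1)) := by
      field_simp
      ring
    rw [hy, ← one_div (1 + _), le_div_iff₀ (by positivity)]
    nlinarith [sq_nonneg (α * (1 / ((n : ℝ) + 1)))]

lemma measurableSet_I (m : ℕ → ℕ) (s : ℕ) : MeasurableSet (I m s) := by
  have h : I m s = ⋂ j ∈ Finset.range s, (fun x : G m => x j) ⁻¹' {0} := by
    ext x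
    simp [I]
  rw [h]
  exact Finset.measurableSet_biInter _ fun j _ =>
    measurable_pi_apply j (MeasurableSpace.measurableSet_top)

lemma lintegral_indicator_I {m : ℕ → ℕ} (hm2 : ∀ k, 2 ≤ m k) (μ : Measure (G m))
    (hμ : ∀ (n : ℕ) (x : G m), μ {y : G m | ∀ j < n, y j = x j} = (M m n : ℝ≥0∞)⁻¹) (s : ℕ) :
    ∫⁻ u, (I m s).indicator (fun _ => (M m s : ℝ≥0∞)) u ∂μ = 1 := by
  have hI : μ (I m s) = (M m s : ℝ≥0∞)⁻¹ := hμ s 0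
  rw [lintegral_indicator (measurableSet_I m s), setLIntegral_const, hI]
  exact ENNReal.mul_inv_cancel (by exact_mod_cast (M_pos hm2 s).ne') (ENNReal.natCast_ne_top _)

/-- Pointwise bound for weighted sums of Vilenkin functions with antitone weights. -/
lemma norm_sum_mul_psiTrunc_le {m : ℕ → ℕ} (hm2 : ∀ k, 2 ≤ m k) {B : ℕ} (hB : ∀ k, m k ≤ B)
    {a : ℕ → ℝ} (ha : Antitone a) (ha0 : ∀ n, 0 ≤ a n) {k N : ℕ} (hN : N < M m k) (x : G m) :
    ‖∑ v ∈ Finset.range N, (a v : ℂ) * psiTrunc m k v x‖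
      ≤ ∑ s ∈ Finset.range k,
          a (M m s - 1) * (B * (I m s).indicator (fun _ => (M m s : ℝ)) x) := by
  set W : ℕ → ℝ := fun s => B * (I m s).indicator (fun _ => (M m s : ℝ)) x with hW
  have hw : ∀ s, 0 ≤ W s := fun s =>
    mul_nonneg (by positivity) (Set.indicator_nonneg (fun _ _ => by positivity) _)
  have hiff : ∀ s v, v + 1 = M m s ↔ v = M m s - 1 := fun s v => by
    have := M_pos hm2 s
    omega
  refine (norm_sum_mul_le_of_antitone ha ha0 _
    (fun v => ∑ s ∈ Finset.range k, if v + 1 = M m s then W s else 0) N fun n hn => ?_).trans ?_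
  · refine (norm_sum_psiTrunc_le hm2 hB x k n (hn.trans_lt hN)).trans_eq ?_
    rw [Finset.sum_comm]
    refine Finset.sum_congr rfl fun s _ => ?_
    simp only [hiff, Finset.sum_ite_eq', Finset.mem_range]
    have := M_pos hm2 s
    exact if_congr (by omega) rfl rfl
  · simp only [Finset.mul_sum]
    rw [Finset.sum_comm]
    refine Finset.sum_le_sum fun s _ => ?_
    simp only [hiff, mul_ite, mul_zero, Finset.sum_ite_eq', Finset.mem_range]
    split_ifs
    · exact le_rfl
    · exact mul_nonneg (ha0 _) (hw s)

/-- Reversing a block turns it into an initial segment, up to a unimodular factor. -/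
lemma norm_sum_Icc_psi_eq {m : ℕ → ℕ} (hm2 : ∀ k, 2 ≤ m k) (b : ℕ → ℝ) {j k : ℕ}
    (hjk : j ≤ k) {n : ℕ} (hn : M m k ≤ n) (x : G m) :
    ‖∑ v ∈ Finset.Icc (M m j) (M m k - 1), (b (n - v) : ℂ) * psi m v x‖
      = ‖∑ v ∈ Finset.range (M m k - M m j),
          (b (v + 1 + (n - M m k)) : ℂ) * psiTrunc m k v x‖ := by
  have hMj := M_pos hm2 j
  have hMk := M_pos hm2 k
  have hle : M m j ≤ M m k := Nat.le_of_dvd hMk (M_dvd_M_of_le m hjk)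
  have e : ∑ v ∈ Finset.Icc (M m j) (M m k - 1), (b (n - v) : ℂ) * psi m v x
      = psiTrunc m k (M m k - 1) x * (starRingEnd ℂ) (∑ v ∈ Finset.range (M m k - M m j),
          (b (v + 1 + (n - M m k)) : ℂ) * psiTrunc m k v x) := by
    rw [map_sum, Finset.mul_sum]
    refine Finset.sum_bij' (fun v _ => M m k - 1 - v) (fun v _ => M m k - 1 - v) ?_ ?_ ?_ ?_ ?_
    · intro v hv
      simp only [Finset.mem_Icc, Finset.mem_range] at hv ⊢
      omega
    · intro v hv
      simp only [Finset.mem_Icc, Finset.mem_range] at hv ⊢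
      omega
    · intro v hv
      simp only [Finset.mem_Icc] at hv
      omega
    · intro v hv
      simp only [Finset.mem_range] at hv
      omega
    · intro v hv
      simp only [Finset.mem_Icc] at hv
      have hvk : v < M m k := by omega
      have hidx : M m k - 1 - v + 1 + (n - M m k) = n - v := by omega
      have hconj : psiTrunc m k (M m k - 1 - v) x
          * (starRingEnd ℂ) (psiTrunc m k (M m k - 1 - v) x) = 1 := by
        rw [Complex.mul_conj, Complex.normSq_eq_norm_sq, norm_psiTrunc]
        simp
      rw [hidx, map_mul, Complex.conj_ofReal, psi_eq_psiTrunc hm2 hvk,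
        ← psiTrunc_reflect hm2 x k v hvk]
      linear_combination (-(b (n - v) : ℂ) * psiTrunc m k v x) * hconj
  rw [e, norm_mul, norm_psiTrunc, one_mul, RCLike.norm_conj]

theorem statement_9 (m : ℕ → ℕ) (hm2 : ∀ k, 2 ≤ m k) (hmbd : ∃ B, ∀ k, m k ≤ B)
    (μ : Measure (G m)) [IsProbabilityMeasure μ]
    (hμ : ∀ (n : ℕ) (x : G m), μ {y : G m | ∀ j < n, y j = x j} = (M m n : ℝ≥0∞)⁻¹)
    (α : ℝ) (hα : α ∈ Set.Ioo (0 : ℝ) 1) :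
    ∃ c : ℝ≥0, 0 < c ∧ ∀ k n : ℕ, 1 ≤ k → M m k ≤ n → n < M m (k + 1) →
      ∫⁻ u, (‖(∑ v ∈ Finset.Icc (M m (k - 1)) (M m k - 1),
          ((A (-α) (n - v) : ℝ) : ℂ) * psi m v u)‖₊ : ℝ≥0∞) ∂μ ≤ c := by
  obtain ⟨B, hB⟩ := hmbd
  have hBpos : 0 < B := by
    have := hm2 0
    have := hB 0
    omega
  obtain ⟨hα0, hα1⟩ := hα
  set ρ : ℝ := 2 ^ (-α) with hρ
  have hρ0 : 0 < ρ := by positivity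
  have hρ1 : ρ < 1 := Real.rpow_lt_one_of_one_lt_of_neg one_lt_two (by linarith)
  have hc : 0 < (B : ℝ) * (1 - ρ)⁻¹ :=
    mul_pos (by exact_mod_cast hBpos) (inv_pos.mpr (by linarith))
  refine ⟨Real.toNNReal (B * (1 - ρ)⁻¹), Real.toNNReal_pos.mpr hc, fun k n hk hn _ => ?_⟩
  have hanti := antitone_A_neg hα0.le hα1.le
  have hweight : ∀ s, A (-α) (M m s - 1 + 1 + (n - M m k)) ≤ ρ ^ s := fun s => by
    have hM := M_pos hm2 s
    have hMs : (2 : ℝ) ^ s ≤ M m s := by exact_mod_cast two_pow_le_M hm2 s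
    calc A (-α) (M m s - 1 + 1 + (n - M m k)) ≤ A (-α) (M m s) := hanti (by omega)
      _ ≤ ((M m s : ℝ) + 1) ^ (-α) := A_neg_le_rpow hα0.le hα1.le _
      _ ≤ ((2 : ℝ) ^ s) ^ (-α) :=
        Real.rpow_le_rpow_of_nonpos (by positivity) (by linarith) (by linarith)
      _ = ρ ^ s := by rw [hρ, ← Real.rpow_natCast, ← Real.rpow_natCast, ← Real.rpow_mul zero_le_two,
          ← Real.rpow_mul zero_le_two, mul_comm]
  have hpt : ∀ u, (‖(∑ v ∈ Finset.Icc (M m (k - 1)) (M m k - 1),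
          ((A (-α) (n - v) : ℝ) : ℂ) * psi m v u)‖₊ : ℝ≥0∞)
      ≤ ∑ s ∈ Finset.range k, ENNReal.ofReal (ρ ^ s * B)
          * (I m s).indicator (fun _ => (M m s : ℝ≥0∞)) u := by
    intro u
    have hMk := M_pos hm2 k
    have hMk' := M_pos hm2 (k - 1)
    have hanti' : Antitone fun v => A (-α) (v + 1 + (n - M m k)) :=
      fun v w hvw => hanti (by omega)
    have hbound := norm_sum_mul_psiTrunc_le hm2 hB hanti' (fun v => A_neg_nonneg hα1.le _)
      (k := k) (N := M m k - M m (k - 1)) (by omega) u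
    rw [← norm_sum_Icc_psi_eq hm2 (A (-α)) (Nat.sub_le k 1) hn u] at hbound
    rw [← enorm_eq_nnnorm, ← ofReal_norm]
    refine (ENNReal.ofReal_le_ofReal hbound).trans ?_
    have hind : ∀ s, 0 ≤ B * (I m s).indicator (fun _ => (M m s : ℝ)) u := fun s =>
      mul_nonneg (by positivity) (Set.indicator_nonneg (fun _ _ => by positivity) _)
    rw [ENNReal.ofReal_sum_of_nonneg fun s _ => mul_nonneg (A_neg_nonneg hα1.le _) (hind s)]
    refine Finset.sum_le_sum fun s _ => ?_
    refine (ENNReal.ofReal_le_ofReal (mul_le_mul_of_nonneg_right (hweight s) (hind s))).trans_eq ?_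
    rw [← mul_assoc, ENNReal.ofReal_mul (by positivity)]
    congr 1
    by_cases hu : u ∈ I m s <;> simp [hu]
  have hmeas : ∀ s, Measurable ((I m s).indicator (fun _ => (M m s : ℝ≥0∞))) := fun s =>
    measurable_const.indicator (measurableSet_I m s)
  refine (lintegral_mono hpt).trans ?_
  rw [lintegral_finsetSum _ fun s _ => (hmeas s).const_mul _]
  simp_rw [lintegral_const_mul _ (hmeas _), lintegral_indicator_I hm2 μ hμ, mul_one]
  rw [← ENNReal.ofReal_sum_of_nonneg fun s _ => by positivity]
  refine ENNReal.ofReal_le_ofReal ?_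
  rw [← Finset.sum_mul, mul_comm]
  refine mul_le_mul_of_nonneg_left ?_ (by positivity)
  rw [← tsum_geometric_of_lt_one hρ0.le hρ1]
  exact (summable_geometric_of_lt_one hρ0.le hρ1).sum_le_tsum _ fun s _ => by positivity

end Vilenkin
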